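/- Let n ∈ ℕ₀ and let λ, γ be real numbers with λ > −1 and 0 < γ < λ+1. Then ∫_{−1}^{1} (1−x)^{λ/2−γ} (1+x)^{λ/2} 𝖯_{n+λ}^{−λ}(x) dx = 2^{λ−γ+1} Γ(λ−γ+1) Γ(γ+n) / (Γ(γ) Γ(2λ−γ+n+2)). -/

import Mathlib

/-- Pochhammer symbol `(a)_k = a (a+1) ⋯ (a+k-1)` for complex `a`. -/
noncomputable def cpoch (a : ℂ) (k : ℕ) : ℂ := ∏ i ∈ Finset.range k, (a + i)

/-- Gauss hypergeometric series `₂F₁(a, b; c; z)`. -/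
noncomputable def hyp2F1 (a b c z : ℂ) : ℂ :=
  ∑' k : ℕ, cpoch a k * cpoch b k / (cpoch c k * (Nat.factorial k : ℂ)) * z ^ k

/-- Ferrers function of the first kind `𝖯_ν^{−μ}(x)`. -/
noncomputable def ferrersP (ν μ : ℂ) (x : ℝ) : ℂ :=
  (1 / Complex.Gamma (μ + 1)) * (((1 - x) / (1 + x) : ℝ) : ℂ) ^ (μ / 2) *
    hyp2F1 (-ν) (ν + 1) (μ + 1) (((1 - x) / 2 : ℝ) : ℂ)

theorem cpoch_zero (a : ℂ) : cpoch a 0 = 1 := by simp [cpoch]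

theorem cpoch_succ (a : ℂ) (k : ℕ) : cpoch a (k + 1) = cpoch a k * (a + k) := by
  simp [cpoch, Finset.prod_range_succ]

theorem cpoch_eq_ascPochhammer_eval (a : ℂ) (k : ℕ) :
    cpoch a k = (ascPochhammer ℂ k).eval a := by
  induction k with
  | zero => simp [cpoch_zero]
  | succ k ih => rw [cpoch_succ, ih, ascPochhammer_succ_eval]

theorem cpoch_ne_zero {c : ℂ} (hc : ∀ k : ℕ, c + k ≠ 0) (k : ℕ) : cpoch c k ≠ 0 :=
  Finset.prod_ne_zero_iff.mpr fun i _ => hc i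

theorem cpoch_add (a : ℂ) (k j : ℕ) : cpoch a (k + j) = cpoch a k * cpoch (a + k) j := by
  simp [cpoch, Finset.prod_range_add, add_assoc]

/-- Reflection of a Pochhammer symbol: `(-a - k - j)_j = (-1)^j (a + 1 + k)_j`. -/
theorem cpoch_neg_sub (a : ℂ) (k j : ℕ) :
    cpoch (-a - (k + j : ℕ)) j = (-1) ^ j * cpoch (a + 1 + k) j := by
  have hpow : (-1 : ℂ) ^ j = ∏ _i ∈ Finset.range j, (-1) := by simp
  rw [cpoch, cpoch, ← Finset.prod_range_reflect, hpow, ← Finset.prod_mul_distrib]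
  refine Finset.prod_congr rfl fun i hi => ?_
  have h' : ((j - 1 - i : ℕ) : ℂ) = j - 1 - i := by
    have h : j - 1 - i + i + 1 = j := by have := Finset.mem_range.mp hi; omega
    have hC : ((j - 1 - i : ℕ) : ℂ) + i + 1 = j := by exact_mod_cast h
    linear_combination hC
  rw [h']
  push_cast
  ring

theorem cpoch_neg_natCast (k j : ℕ) :
    cpoch (-(k + j : ℕ)) k * (j.factorial : ℂ) = (-1) ^ k * ((k + j).factorial : ℂ) := by
  have h := cpoch_neg_sub 0 j k
  have h1 := cpoch_add 1 j k
  have fac (m : ℕ) : cpoch 1 m = m.factorial := by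
    rw [cpoch_eq_ascPochhammer_eval, ascPochhammer_eval_one]
  rw [fac, fac] at h1
  rw [neg_zero, zero_sub, zero_add, add_comm j k] at h
  rw [add_comm j k] at h1
  rw [h, h1]
  ring

theorem cpoch_neg_natCast_eq_zero {n k : ℕ} (h : n < k) : cpoch (-(n : ℂ)) k = 0 :=
  Finset.prod_eq_zero (Finset.mem_range.mpr h) (by simp)

/-- The **Pfaff–Saalschütz** summation, as a Cauchy product of coefficients. -/
theorem sum_antidiagonal_cpoch_mul_cpoch (a b : ℂ) {c : ℂ} (hc : ∀ k : ℕ, c + k ≠ 0) (m : ℕ) :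
    ∑ p ∈ Finset.HasAntidiagonal.antidiagonal m,
        cpoch a p.1 * cpoch b p.1 / (cpoch c p.1 * (p.1.factorial : ℂ)) *
          (cpoch (c - a - b) p.2 / (p.2.factorial : ℂ)) =
      cpoch (c - a) m * cpoch (c - b) m / (cpoch c m * (m.factorial : ℂ)) := by
  set x : ℕ → ℂ := fun k => cpoch a k * cpoch b k / (cpoch c k * (k.factorial : ℂ)) with hx
  set y : ℕ → ℂ := fun k => cpoch (c - a - b) k / (k.factorial : ℂ) with hy
  have hc' := cpoch_ne_zero hc
  have hf (k : ℕ) : (k.factorial : ℂ) ≠ 0 := by exact_mod_cast k.factorial_ne_zero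
  have hs (k : ℕ) : (k : ℂ) + 1 ≠ 0 := by exact_mod_cast k.succ_ne_zero
  have hxs (k : ℕ) : ((k : ℂ) + 1) * (c + k) * x (k + 1) = (a + k) * (b + k) * x k := by
    simp only [hx, cpoch_succ, Nat.factorial_succ]
    push_cast
    field_simp [hc k, hc' k, hf k, hs k]
  have hys (k : ℕ) : ((k : ℂ) + 1) * y (k + 1) = (c - a - b + k) * y k := by
    simp only [hy, cpoch_succ, Nat.factorial_succ]
    push_cast
    field_simp [hf k, hs k]
  change ∑ p ∈ Finset.HasAntidiagonal.antidiagonal m, x p.1 * y p.2 = _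
  induction m with
  | zero => simp [hx, hy, cpoch_zero]
  | succ m ih =>
    have key : ((m : ℂ) + 1) * (c + m) * ∑ p ∈ Finset.HasAntidiagonal.antidiagonal (m + 1), x p.1 * y p.2 =
        (c - a + m) * (c - b + m) * ∑ p ∈ Finset.HasAntidiagonal.antidiagonal m, x p.1 * y p.2 := by
      have split : ((m : ℂ) + 1) * (c + m) * ∑ p ∈ Finset.HasAntidiagonal.antidiagonal (m + 1), x p.1 * y p.2 =
          ∑ p ∈ Finset.HasAntidiagonal.antidiagonal (m + 1), (p.1 : ℂ) * (c + p.1 - 1) * x p.1 * y p.2 +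
          ∑ p ∈ Finset.HasAntidiagonal.antidiagonal (m + 1), (c + m + p.1) * x p.1 * (p.2 * y p.2) := by
        rw [Finset.mul_sum, ← Finset.sum_add_distrib]
        refine Finset.sum_congr rfl fun p hp => ?_
        have h : (p.1 : ℂ) + p.2 = m + 1 := by exact_mod_cast Finset.HasAntidiagonal.mem_antidiagonal.mp hp
        linear_combination (-(x p.1 * y p.2) * (c + m + p.1)) * h
      rw [split, Finset.Nat.sum_antidiagonal_succ, Finset.Nat.sum_antidiagonal_succ']
      simp only [Nat.cast_zero, zero_mul, mul_zero, zero_add, add_zero]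
      rw [← Finset.sum_add_distrib, Finset.mul_sum]
      refine Finset.sum_congr rfl fun p hp => ?_
      have h : (p.1 : ℂ) + p.2 = m := by exact_mod_cast Finset.HasAntidiagonal.mem_antidiagonal.mp hp
      have h1 := hxs p.1
      have h2 := hys p.2
      rw [← h] at *
      push_cast
      linear_combination y p.2 * h1 + (c + (p.1 + p.2) + p.1) * x p.1 * h2
    rw [ih] at key
    refine mul_left_cancel₀ (mul_ne_zero (hs m) (hc m)) (key.trans ?_)
    simp only [cpoch_succ, Nat.factorial_succ]
    push_cast
    field_simp [hc m, hc' m, hf m, hs m]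

theorem choose_mul_neg_pow (l z : ℂ) (j : ℕ) :
    Ring.choose l j * (-z) ^ j = cpoch (-l) j / (j.factorial : ℂ) * z ^ j := by
  rw [Ring.choose_eq_smul, Polynomial.descPochhammer_smeval_eq_ascPochhammer,
    Polynomial.ascPochhammer_smeval_cast, Polynomial.ascPochhammer_smeval_eq_eval,
    cpoch_eq_ascPochhammer_eval, ascPochhammer_eval_neg_eq_descPochhammer,
    descPochhammer_eval_eq_ascPochhammer, neg_pow, smul_eq_mul]
  ring

/-- The binomial series for `(1 - z) ^ l`. -/
theorem hasSum_one_sub_cpow (l : ℂ) {z : ℂ} (hz : ‖z‖ < 1) :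
    HasSum (fun j : ℕ => cpoch (-l) j / (j.factorial : ℂ) * z ^ j) ((1 - z) ^ l) ∧
      Summable fun j : ℕ => ‖cpoch (-l) j / (j.factorial : ℂ) * z ^ j‖ := by
  have hmem : -z ∈ Metric.eball (0 : ℂ) 1 := by
    rw [← ENNReal.ofReal_one, Metric.eball_ofReal]
    simpa using hz
  have h := Complex.one_add_cpow_hasFPowerSeriesOnBall_zero (a := l)
  have h1 := h.hasSum hmem
  have h2 := (binomialSeries ℂ l).summable_norm_apply (Metric.eball_subset_eball h.r_le hmem)
  simp only [binomialSeries_apply, List.ofFn_const, List.prod_replicate, smul_eq_mul,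
    choose_mul_neg_pow, zero_add] at h1 h2
  rw [← sub_eq_add_neg] at h1
  exact ⟨h1, h2⟩

/-- **Euler's transformation** when the transformed series terminates. -/
theorem hyp2F1_eq_one_sub_cpow_mul_sum (n : ℕ) {c : ℂ} (hc : ∀ k : ℕ, c + k ≠ 0) (b : ℂ)
    {z : ℂ} (hz : ‖z‖ < 1) :
    hyp2F1 (c + n) (c - b) c z =
      (1 - z) ^ (b - n - c) * ∑ k ∈ Finset.range (n + 1),
        cpoch (-n) k * cpoch b k / (cpoch c k * (k.factorial : ℂ)) * z ^ k := by
  obtain ⟨hs, hn⟩ := hasSum_one_sub_cpow (b - n - c) hz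
  set x : ℕ → ℂ := fun k =>
    cpoch (-n) k * cpoch b k / (cpoch c k * (k.factorial : ℂ)) * z ^ k with hx
  have hx0 : ∀ k ∉ Finset.range (n + 1), x k = 0 := fun k hk => by
    have : n < k := by simpa using hk
    simp [hx, cpoch_neg_natCast_eq_zero this]
  have hxn : Summable fun k => ‖x k‖ :=
    summable_of_ne_finset_zero (s := Finset.range (n + 1)) fun k hk => by simp [hx0 k hk]
  rw [← tsum_eq_sum (L := .unconditional ℕ) hx0, ← hs.tsum_eq, mul_comm,
    tsum_mul_tsum_eq_tsum_sum_antidiagonal_of_summable_norm hxn hn, hyp2F1]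
  refine tsum_congr fun m => ?_
  have h := sum_antidiagonal_cpoch_mul_cpoch (-n) b hc m
  rw [sub_neg_eq_add] at h
  rw [← h, Finset.sum_mul]
  refine Finset.sum_congr rfl fun p hp => ?_
  rw [← Finset.HasAntidiagonal.mem_antidiagonal.mp hp, pow_add, show -(b - n - c) = c + n - b by ring]
  ring

theorem add_natCast_ne_zero_of_re_pos {s : ℂ} (hs : 0 < s.re) (k : ℕ) : s + k ≠ 0 := by
  intro h
  have := congrArg Complex.re h
  simp only [Complex.add_re, Complex.natCast_re, Complex.zero_re] at this
  have : (0 : ℝ) ≤ k := k.cast_nonneg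
  linarith

theorem Gamma_add_natCast {s : ℂ} (hs : 0 < s.re) (k : ℕ) :
    Complex.Gamma (s + k) = cpoch s k * Complex.Gamma s := by
  rw [cpoch_eq_ascPochhammer_eval, ← Complex.Gamma_add_nat_div_Gamma_eq, div_mul_cancel₀]
  · exact Complex.Gamma_ne_zero_of_re_pos hs
  · intro k h
    exact add_natCast_ne_zero_of_re_pos hs k (by rw [h]; ring)

theorem betaIntegral_add_natCast {s v : ℂ} (hs : 0 < s.re) (hv : 0 < v.re) (k : ℕ) :
    Complex.betaIntegral (s + k) v =
      cpoch s k / cpoch (s + v) k * Complex.betaIntegral s v := by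
  have hsv : 0 < (s + v).re := by simpa using add_pos hs hv
  have hk : 0 < (s + k).re := by simpa using add_pos_of_pos_of_nonneg hs k.cast_nonneg
  rw [Complex.betaIntegral_eq_Gamma_mul_div _ _ hk hv,
    Complex.betaIntegral_eq_Gamma_mul_div _ _ hs hv, show s + k + v = s + v + k by ring, Gamma_add_natCast hs, Gamma_add_natCast hsv]
  have := cpoch_ne_zero (add_natCast_ne_zero_of_re_pos hsv) k
  have := Complex.Gamma_ne_zero_of_re_pos hsv
  field_simp

/-- The Saalschützian `₃F₂(-n, 2v + n - 1, s; v, s + v; 1)`. -/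
theorem sum_saalschutz {s v : ℂ} (hv : 0 < v.re) (hsv : 0 < (s + v).re) (n : ℕ) :
    ∑ k ∈ Finset.range (n + 1),
        cpoch (-n) k * cpoch (2 * v + n - 1) k / (cpoch v k * (k.factorial : ℂ)) *
          (cpoch s k / cpoch (s + v) k) =
      cpoch (v - s) n / cpoch (s + v) n := by
  have hc := add_natCast_ne_zero_of_re_pos hsv
  have hv' := cpoch_ne_zero (add_natCast_ne_zero_of_re_pos hv)
  have hc' := cpoch_ne_zero hc
  have hf (k : ℕ) : (k.factorial : ℂ) ≠ 0 := by exact_mod_cast k.factorial_ne_zero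
  have h := sum_antidiagonal_cpoch_mul_cpoch s (2 * v + n - 1) hc n
  have h3 := cpoch_neg_sub (v - s - 1) 0 n
  rw [show s + v - (2 * v + n - 1) = -(v - s - 1) - (0 + n : ℕ) by push_cast; ring, h3,
    add_sub_cancel_left] at h
  have e : ∑ k ∈ Finset.range (n + 1),
        cpoch (-n) k * cpoch (2 * v + n - 1) k / (cpoch v k * (k.factorial : ℂ)) *
          (cpoch s k / cpoch (s + v) k) = (-1) ^ n * (n.factorial : ℂ) / cpoch v n *
      ∑ p ∈ Finset.HasAntidiagonal.antidiagonal n, cpoch s p.1 * cpoch (2 * v + n - 1) p.1 /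
        (cpoch (s + v) p.1 * (p.1.factorial : ℂ)) *
          (cpoch (v - (2 * v + n - 1)) p.2 / (p.2.factorial : ℂ)) := by
    rw [← Finset.Nat.sum_antidiagonal_eq_sum_range_succ_mk (fun p : ℕ × ℕ =>
      cpoch (-n) p.1 * cpoch (2 * v + n - 1) p.1 / (cpoch v p.1 * (p.1.factorial : ℂ)) *
          (cpoch s p.1 / cpoch (s + v) p.1)), Finset.mul_sum]
    refine Finset.sum_congr rfl fun p hp => ?_
    obtain ⟨k, j⟩ := p
    obtain rfl : k + j = n := Finset.HasAntidiagonal.mem_antidiagonal.mp hp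
    have h1 := cpoch_neg_sub (v - 1) k j
    rw [show -(v - 1) - (k + j : ℕ) = v - (2 * v + (k + j : ℕ) - 1) by ring, sub_add_cancel] at h1
    have h2 := cpoch_neg_natCast k j
    have h4 := cpoch_add v k j
    have hvk : cpoch (v + k) j ≠ 0 := fun h0 => hv' (k + j) (by rw [h4, h0, mul_zero])
    rw [h1, h4, eq_div_of_mul_eq (hf j) h2]
    have hj : ((-1 : ℂ) ^ j) * (-1) ^ j = 1 := by rw [← mul_pow]; simp
    have := hv' k
    have := hc' k
    have := hf k
    have := hf j
    simp only [pow_add]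
    field_simp
    linear_combination (-(((k + j).factorial : ℂ) * cpoch s k *
      cpoch (2 * v + (k + j : ℕ) - 1) k)) * hj
  rw [e, h]
  have := hv' n
  have := hc' n
  have := hf n
  have hj : ((-1 : ℂ) ^ n) * (-1) ^ n = 1 := by rw [← mul_pow]; simp
  simp only [Nat.cast_zero, add_zero, sub_add_cancel]
  field_simp
  linear_combination (cpoch (v - s) n) * hj

theorem integral_cpow_mul_one_sub_cpow_mul_sum {s v : ℂ} (hs : 0 < s.re) (hv : 0 < v.re)
    (N : ℕ) (f : ℕ → ℂ) :
    ∫ t in (0 : ℝ)..1, (t : ℂ) ^ (s - 1) * (1 - (t : ℂ)) ^ (v - 1) *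
        ∑ k ∈ Finset.range N, f k * (t : ℂ) ^ k =
      Complex.betaIntegral s v * ∑ k ∈ Finset.range N, f k * (cpoch s k / cpoch (s + v) k) := by
  have hk (k : ℕ) : 0 < (s + k).re := by simpa using add_pos_of_pos_of_nonneg hs k.cast_nonneg
  have e : Set.EqOn (fun t : ℝ => (t : ℂ) ^ (s - 1) * (1 - (t : ℂ)) ^ (v - 1) *
        ∑ k ∈ Finset.range N, f k * (t : ℂ) ^ k)
      (fun t : ℝ => ∑ k ∈ Finset.range N,
        f k * ((t : ℂ) ^ (s + k - 1) * (1 - (t : ℂ)) ^ (v - 1))) (Set.Ioo 0 1) := fun t ht => by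
    have h0 : (t : ℂ) ≠ 0 := by exact_mod_cast ht.1.ne'
    simp only [Finset.mul_sum]
    refine Finset.sum_congr rfl fun k _ => ?_
    rw [show s + k - 1 = s - 1 + k by ring, Complex.cpow_add _ _ h0, Complex.cpow_natCast]
    ring
  rw [intervalIntegral.integral_congr_Ioo_of_le zero_le_one e,
    intervalIntegral.integral_finsetSum fun k _ =>
      (Complex.betaIntegral_convergent (hk k) hv).const_mul _, Finset.mul_sum]
  refine Finset.sum_congr rfl fun k _ => ?_
  rw [intervalIntegral.integral_const_mul]
  change f k * Complex.betaIntegral (s + k) v = _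
  rw [betaIntegral_add_natCast hs hv]
  ring

theorem ferrersP_definite_integral (n : ℕ) (lam gam : ℝ) (hlam : -1 < lam)
    (hgam0 : 0 < gam) (hgam1 : gam < lam + 1) :
    ∫ x in (-1 : ℝ)..1,
        (((1 - x) ^ (lam / 2 - gam) : ℝ) : ℂ) * (((1 + x) ^ (lam / 2) : ℝ) : ℂ) *
          ferrersP ((n : ℂ) + lam) (lam : ℂ) x =
      ((2 ^ (lam - gam + 1) * Real.Gamma (lam - gam + 1) * Real.Gamma (gam + n) /
          (Real.Gamma gam * Real.Gamma (2 * lam - gam + n + 2)) : ℝ) : ℂ) := by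
  set s : ℂ := ((lam - gam + 1 : ℝ) : ℂ) with hs_def
  set v : ℂ := ((lam + 1 : ℝ) : ℂ) with hv_def
  have hs : 0 < s.re := by rw [hs_def, Complex.ofReal_re]; linarith
  have hv : 0 < v.re := by rw [hv_def, Complex.ofReal_re]; linarith
  have hsv : 0 < (s + v).re := by simpa using add_pos hs hv
  set f : ℕ → ℂ := fun k =>
    cpoch (-n) k * cpoch (2 * v + n - 1) k / (cpoch v k * (k.factorial : ℂ)) with hf
  set F : ℝ → ℂ := fun t => (t : ℂ) ^ (s - 1) * (1 - (t : ℂ)) ^ (v - 1) *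
    ∑ k ∈ Finset.range (n + 1), f k * (t : ℂ) ^ k with hF
  set C : ℂ := ((2 ^ (lam - gam) : ℝ) : ℂ) / Complex.Gamma v with hC
  have integrand : Set.EqOn (fun x : ℝ =>
      (((1 - x) ^ (lam / 2 - gam) : ℝ) : ℂ) * (((1 + x) ^ (lam / 2) : ℝ) : ℂ) *
          ferrersP ((n : ℂ) + lam) (lam : ℂ) x) (fun x => C * F (1 / 2 - x / 2))
      (Set.Ioo (-1) 1) := fun x hx => by
    obtain ⟨t, rfl⟩ : ∃ t : ℝ, x = 1 - 2 * t := ⟨(1 - x) / 2, by ring⟩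
    have ht0 : 0 < t := by linarith [hx.2]
    have ht1 : t < 1 := by linarith [hx.1]
    have hz : ‖(t : ℂ)‖ < 1 := by simpa [abs_of_pos ht0] using ht1
    have hyp := hyp2F1_eq_one_sub_cpow_mul_sum n (add_natCast_ne_zero_of_re_pos hv)
      (2 * v + n - 1) hz
    have swap (a b c z : ℂ) : hyp2F1 a b c z = hyp2F1 b a c z := by
      simp only [hyp2F1, mul_comm (cpoch a _)]
    rw [show 2 * v + n - 1 - n - v = v - 1 by ring, swap,
      show v - (2 * v + n - 1) = -((n : ℂ) + lam) by rw [hv_def]; push_cast; ring,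
      show v + n = (n : ℂ) + lam + 1 by rw [hv_def]; push_cast; ring] at hyp
    have hvl : v = (lam : ℂ) + 1 := by rw [hv_def]; push_cast; ring
    have hpow : (1 - (1 - 2 * t)) ^ (lam / 2 - gam) * (1 + (1 - 2 * t)) ^ (lam / 2) *
        ((1 - (1 - 2 * t)) / (1 + (1 - 2 * t))) ^ (lam / 2) =
        2 ^ (lam - gam) * t ^ (lam - gam) := by
      rw [show 1 - (1 - 2 * t) = 2 * t by ring, show 1 + (1 - 2 * t) = 2 * (1 - t) by ring,
        Real.div_rpow (by positivity) (by nlinarith), mul_assoc, mul_div_cancel₀,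
        ← Real.rpow_add (by positivity), ← Real.mul_rpow (by positivity) ht0.le]
      · ring_nf
      · exact (Real.rpow_pos_of_pos (by linarith) _).ne'
    have hpos : 0 ≤ (1 - (1 - 2 * t)) / (1 + (1 - 2 * t)) :=
      div_nonneg (by linarith) (by linarith)
    simp only [ferrersP]
    rw [show (1 - (1 - 2 * t)) / 2 = t by ring, show 1 / 2 - (1 - 2 * t) / 2 = t by ring,
      ← hvl, hyp, hC, hF, show (lam : ℂ) / 2 = ((lam / 2 : ℝ) : ℂ) by push_cast; ring,
      ← Complex.ofReal_cpow hpos,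
      show s - 1 = ((lam - gam : ℝ) : ℂ) by rw [hs_def]; push_cast; ring]
    have hpowC := congrArg ((↑) : ℝ → ℂ) hpow
    rw [Complex.ofReal_mul, Complex.ofReal_mul ((1 - _) ^ _), Complex.ofReal_mul (2 ^ (lam - gam)),
      Complex.ofReal_cpow ht0.le] at hpowC
    linear_combination (1 / Complex.Gamma v * ((1 - (t : ℂ)) ^ (v - 1) *
      ∑ k ∈ Finset.range (n + 1), f k * (t : ℂ) ^ k)) * hpowC
  have hGv := Complex.Gamma_ne_zero_of_re_pos hv
  have hGsv := Complex.Gamma_ne_zero_of_re_pos hsv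
  have hg : 0 < (gam : ℂ).re := hgam0
  have hGg := Complex.Gamma_ne_zero_of_re_pos hg
  have hcsv := cpoch_ne_zero (add_natCast_ne_zero_of_re_pos hsv) n
  rw [intervalIntegral.integral_congr_Ioo_of_le (by norm_num) integrand,
    intervalIntegral.integral_const_mul,
    intervalIntegral.integral_comp_sub_div F two_ne_zero (1 / 2)]
  norm_num only
  rw [hF, integral_cpow_mul_one_sub_cpow_mul_sum hs hv, sum_saalschutz hv hsv,
    Complex.betaIntegral_eq_Gamma_mul_div _ _ hs hv,
    show v - s = gam by rw [hv_def, hs_def]; push_cast; ring]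
  have e1 : ((Real.Gamma (gam + n) : ℝ) : ℂ) = cpoch gam n * Complex.Gamma gam := by
    rw [← Gamma_add_natCast hg, ← Complex.Gamma_ofReal]; push_cast; rfl
  have e2 : ((Real.Gamma (2 * lam - gam + n + 2) : ℝ) : ℂ) =
      cpoch (s + v) n * Complex.Gamma (s + v) := by
    rw [← Gamma_add_natCast hsv, ← Complex.Gamma_ofReal, hs_def, hv_def]; push_cast; ring_nf
  have e3 : ((2 ^ (lam - gam + 1) : ℝ) : ℂ) = ((2 ^ (lam - gam) : ℝ) : ℂ) * 2 := by
    rw [Real.rpow_add_one two_ne_zero]; push_cast; ring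
  rw [Complex.ofReal_div, Complex.ofReal_mul, Complex.ofReal_mul, Complex.ofReal_mul, e1, e2, e3,
    ← Complex.Gamma_ofReal, ← Complex.Gamma_ofReal, ← hs_def, hC, Complex.real_smul]
  push_cast
  field_simp
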